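/- Let r : [0,1]² → ℝ be continuously differentiable, let K be a positive integer, let (t₁,…,t_K) ∈ T_K be a grid, and set R^K = {r(t_j,t_l)}_{j,l=1}^K. For any real K×K matrix Θ, let r̂(x,y) = Σ_{j,l=1}^K Θ(j,l) 1{(x,y) ∈ I_{j,K} × I_{l,K}} be the step kernel with coefficient matrix Θ. Then ∫₀¹∫₀¹ {r̂(x,y) − r(x,y)}² dx dy ≤ 2 K^{−2} ‖Θ − R^K‖²_F + 4 K^{−2} sup_{(x,y) ∈ [0,1]²} ‖∇r(x,y)‖²₂. -/

import Mathlib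

open MeasureTheory

/-- The `j`-th half-open cell of the regular partition of `[0,1]` lies in `[0,1]`. -/
theorem regularCell_subset_Icc {K : ℕ} (j : Fin K) :
    Set.Ico ((j : ℝ) / K) (((j : ℝ) + 1) / K) ⊆ Set.Icc 0 1 := by
  have hK : (0 : ℝ) < K := by exact_mod_cast j.pos
  have hj : (j : ℝ) + 1 ≤ K := by exact_mod_cast j.isLt
  intro x hx
  refine ⟨le_trans (by positivity) hx.1, hx.2.le.trans ?_⟩
  rw [div_le_one hK]
  exact hj

/-- Distinct cells of the regular partition are disjoint. -/
theorem regularCell_index_unique {K : ℕ} {i j : Fin K} {x : ℝ}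
    (hi : x ∈ Set.Ico ((i : ℝ) / K) (((i : ℝ) + 1) / K))
    (hj : x ∈ Set.Ico ((j : ℝ) / K) (((j : ℝ) + 1) / K)) : i = j := by
  have hK : (0 : ℝ) < K := by exact_mod_cast j.pos
  simp only [Set.mem_Ico, div_le_iff₀ hK, lt_div_iff₀ hK] at hi hj
  have h1 : (i : ℝ) < (j : ℝ) + 1 := hi.1.trans_lt hj.2
  have h2 : (j : ℝ) < (i : ℝ) + 1 := hj.1.trans_lt hi.2
  have h1' : (i : ℕ) < j + 1 := by exact_mod_cast h1
  have h2' : (j : ℕ) < i + 1 := by exact_mod_cast h2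
  ext
  omega

/-- The cells of the regular partition cover `[0,1)`. -/
theorem exists_mem_regularCell {K : ℕ} (hK : 0 < K) {x : ℝ} (hx : x ∈ Set.Ico (0 : ℝ) 1) :
    ∃ j : Fin K, x ∈ Set.Ico ((j : ℝ) / K) (((j : ℝ) + 1) / K) := by
  have hK' : (0 : ℝ) < K := by exact_mod_cast hK
  have h0 : 0 ≤ x * K := mul_nonneg hx.1 hK'.le
  have hlt : ⌊x * K⌋₊ < K := by
    rw [Nat.floor_lt h0]
    nlinarith [hx.2]
  refine ⟨⟨⌊x * K⌋₊, hlt⟩, ?_⟩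
  simp only [Set.mem_Ico, div_le_iff₀ hK', lt_div_iff₀ hK']
  exact ⟨Nat.floor_le h0, Nat.lt_floor_add_one _⟩

/-- A nonnegative function bounded by `b j` on the `j`-th cell has integral at most the mean
of the `b j`. -/
theorem setIntegral_le_of_le_on_regularCells {K : ℕ} (hK : 0 < K) {g : ℝ → ℝ} {b : Fin K → ℝ}
    (hg : ∀ x, 0 ≤ g x)
    (hb : ∀ j : Fin K, ∀ x ∈ Set.Ico ((j : ℝ) / K) (((j : ℝ) + 1) / K), g x ≤ b j) :
    ∫ x in Set.Icc (0 : ℝ) 1, g x ≤ (K : ℝ)⁻¹ * ∑ j, b j := by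
  have hK' : (0 : ℝ) < K := by exact_mod_cast hK
  have hint : ∀ j : Fin K, Integrable
      ((Set.Ico ((j : ℝ) / K) (((j : ℝ) + 1) / K)).indicator fun _ => b j)
      (volume.restrict (Set.Ico (0 : ℝ) 1)) := fun j =>
    (integrable_const (b j)).indicator measurableSet_Ico
  have hval : ∀ j : Fin K, ∫ x in Set.Ico (0 : ℝ) 1,
      (Set.Ico ((j : ℝ) / K) (((j : ℝ) + 1) / K)).indicator (fun _ => b j) x
        = (K : ℝ)⁻¹ * b j := by
    intro j
    have hsub : Set.Ico ((j : ℝ) / K) (((j : ℝ) + 1) / K) ⊆ Set.Icc 0 1 :=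
      regularCell_subset_Icc j
    rw [← integral_Icc_eq_integral_Ico, setIntegral_indicator measurableSet_Ico,
      Set.inter_eq_self_of_subset_right hsub, setIntegral_const, Real.volume_real_Ico_of_le
        (by gcongr; linarith), smul_eq_mul]
    congr 1
    field_simp
    ring
  rw [integral_Icc_eq_integral_Ico, Finset.mul_sum, ← Finset.sum_congr rfl fun j _ => hval j,
    ← integral_finsetSum _ fun j _ => hint j]
  refine integral_mono_of_nonneg (Filter.Eventually.of_forall hg)
    (integrable_finsetSum _ fun j _ => hint j) ?_
  refine (ae_restrict_iff' measurableSet_Ico).2 (Filter.Eventually.of_forall fun x hx => ?_)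
  obtain ⟨j, hj⟩ := exists_mem_regularCell hK hx
  refine (hb j x hj).trans (le_of_eq ?_)
  dsimp only
  rw [Finset.sum_eq_single j, Set.indicator_of_mem hj]
  · intro i _ hij
    exact Set.indicator_of_notMem (fun hi => hij (regularCell_index_unique hi hj)) _
  · simp

/-- A `C¹` function on the closed unit square satisfies
`(r p - r q)² ≤ sup ‖∇r‖₂² * ‖p - q‖₂²`. -/
theorem sq_sub_le_iSup_gradient_mul {r : ℝ × ℝ → ℝ}
    (hr : ContDiffOn ℝ 1 r (Set.Icc ((0 : ℝ), (0 : ℝ)) ((1 : ℝ), (1 : ℝ))))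
    {p q : ℝ × ℝ} (hp : p ∈ Set.Icc ((0 : ℝ), (0 : ℝ)) ((1 : ℝ), (1 : ℝ)))
    (hq : q ∈ Set.Icc ((0 : ℝ), (0 : ℝ)) ((1 : ℝ), (1 : ℝ))) :
    (r p - r q) ^ 2 ≤
      (⨆ z : Set.Icc ((0 : ℝ), (0 : ℝ)) ((1 : ℝ), (1 : ℝ)),
        ((fderivWithin ℝ r (Set.Icc ((0 : ℝ), (0 : ℝ)) ((1 : ℝ), (1 : ℝ))) z.1 (1, 0)) ^ 2
          + (fderivWithin ℝ r (Set.Icc ((0 : ℝ), (0 : ℝ)) ((1 : ℝ), (1 : ℝ))) z.1 (0, 1)) ^ 2))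
        * ((p.1 - q.1) ^ 2 + (p.2 - q.2) ^ 2) := by
  set S : Set (ℝ × ℝ) := Set.Icc ((0 : ℝ), (0 : ℝ)) ((1 : ℝ), (1 : ℝ)) with hS
  have hu : UniqueDiffOn ℝ S := by
    rw [hS, ← Set.Icc_prod_Icc]
    exact (uniqueDiffOn_Icc zero_lt_one).prod (uniqueDiffOn_Icc zero_lt_one)
  have hc : ContinuousOn (fderivWithin ℝ r S) S := hr.continuousOn_fderivWithin hu le_rfl
  have hbdd : BddAbove (Set.range fun z : S =>
      (fderivWithin ℝ r S z.1 (1, 0)) ^ 2 + (fderivWithin ℝ r S z.1 (0, 1)) ^ 2) := by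
    have h := (isCompact_Icc : IsCompact S).bddAbove_image
      (f := fun z => (fderivWithin ℝ r S z (1, 0)) ^ 2 + (fderivWithin ℝ r S z (0, 1)) ^ 2)
      (((hc.clm_apply continuousOn_const).pow 2).add ((hc.clm_apply continuousOn_const).pow 2))
    rwa [Set.image_eq_range] at h
  obtain ⟨z, hz, hzeq⟩ := domain_mvt
    (fun x hx => (hr.differentiableOn one_ne_zero x hx).hasFDerivWithinAt)
    (convex_Icc _ _ : Convex ℝ S) hq hp
  have hzS : z ∈ S := (convex_Icc _ _ : Convex ℝ S).segment_subset hq hp hz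
  have hle := le_ciSup hbdd ⟨z, hzS⟩
  have hdecomp : p - q = (p.1 - q.1) • ((1 : ℝ), (0 : ℝ)) + (p.2 - q.2) • ((0 : ℝ), (1 : ℝ)) := by
    ext <;> simp
  rw [hdecomp, map_add, map_smul, map_smul, smul_eq_mul, smul_eq_mul] at hzeq
  rw [hzeq]
  refine le_trans ?_ (mul_le_mul_of_nonneg_right hle (by positivity))
  dsimp only
  nlinarith [sq_nonneg ((p.1 - q.1) * fderivWithin ℝ r S z (0, 1)
    - (p.2 - q.2) * fderivWithin ℝ r S z (1, 0))]

/-- error decomposition for step-kernel estimators.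
For `r` continuously differentiable on `[0,1]²`, a grid `(t₁,…,t_K) ∈ T_K` with
`R^K = {r(t_j,t_l)}`, and any coefficient matrix `Θ`, the step kernel `r̂` with
coefficients `Θ` satisfies
`∫∫ (r̂ − r)² ≤ 2 K⁻² ‖Θ − R^K‖_F² + 4 K⁻² sup_{[0,1]²} ‖∇r‖₂²`. -/
theorem step_kernel_error_decomposition
    (r : ℝ × ℝ → ℝ)
    (hr : ContDiffOn ℝ 1 r (Set.Icc ((0 : ℝ), (0 : ℝ)) ((1 : ℝ), (1 : ℝ))))
    (K : ℕ) (hK : 0 < K)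
    (t : Fin K → ℝ)
    (ht : ∀ j : Fin K, t j ∈ Set.Ico ((j : ℝ) / K) (((j : ℝ) + 1) / K))
    (Θ : Matrix (Fin K) (Fin K) ℝ) :
    (∫ x in Set.Icc (0 : ℝ) 1, ∫ y in Set.Icc (0 : ℝ) 1,
        ((∑ j : Fin K, ∑ l : Fin K,
          if x ∈ Set.Ico ((j : ℝ) / K) (((j : ℝ) + 1) / K)
              ∧ y ∈ Set.Ico ((l : ℝ) / K) (((l : ℝ) + 1) / K)
            then Θ j l else 0) - r (x, y)) ^ 2)
      ≤ 2 * ((K : ℝ) ^ 2)⁻¹ * (∑ j : Fin K, ∑ l : Fin K, (Θ j l - r (t j, t l)) ^ 2)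
        + 4 * ((K : ℝ) ^ 2)⁻¹ *
          ⨆ p : Set.Icc ((0 : ℝ), (0 : ℝ)) ((1 : ℝ), (1 : ℝ)),
            ((fderivWithin ℝ r (Set.Icc ((0 : ℝ), (0 : ℝ)) ((1 : ℝ), (1 : ℝ))) p.1 (1, 0)) ^ 2
              + (fderivWithin ℝ r (Set.Icc ((0 : ℝ), (0 : ℝ)) ((1 : ℝ), (1 : ℝ))) p.1 (0, 1)) ^ 2) := by
  have hK' : (0 : ℝ) < K := by exact_mod_cast hK
  set G : ℝ := ⨆ p : Set.Icc ((0 : ℝ), (0 : ℝ)) ((1 : ℝ), (1 : ℝ)),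
    ((fderivWithin ℝ r (Set.Icc ((0 : ℝ), (0 : ℝ)) ((1 : ℝ), (1 : ℝ))) p.1 (1, 0)) ^ 2
      + (fderivWithin ℝ r (Set.Icc ((0 : ℝ), (0 : ℝ)) ((1 : ℝ), (1 : ℝ))) p.1 (0, 1)) ^ 2) with hG
  have hG0 : 0 ≤ G := Real.iSup_nonneg fun p => by positivity
  have hdist : ∀ (j : Fin K) (x : ℝ), x ∈ Set.Ico ((j : ℝ) / K) (((j : ℝ) + 1) / K) →
      (t j - x) ^ 2 ≤ ((K : ℝ) ^ 2)⁻¹ := by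
    intro j x hx
    have hj := ht j
    have hlen : ((j : ℝ) + 1) / K = (j : ℝ) / K + (K : ℝ)⁻¹ := by
      rw [add_div, one_div]
    rw [hlen] at hx hj
    rw [← inv_pow]
    exact sq_le_sq' (by linarith [hx.2, hj.1]) (by linarith [hx.1, hj.2])
  have hcell : ∀ j : Fin K, ∀ x ∈ Set.Ico ((j : ℝ) / K) (((j : ℝ) + 1) / K),
      ∀ l : Fin K, ∀ y ∈ Set.Ico ((l : ℝ) / K) (((l : ℝ) + 1) / K),
      ((∑ j : Fin K, ∑ l : Fin K,
          if x ∈ Set.Ico ((j : ℝ) / K) (((j : ℝ) + 1) / K)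
              ∧ y ∈ Set.Ico ((l : ℝ) / K) (((l : ℝ) + 1) / K)
            then Θ j l else 0) - r (x, y)) ^ 2
        ≤ 2 * (Θ j l - r (t j, t l)) ^ 2 + 4 * ((K : ℝ) ^ 2)⁻¹ * G := by
    intro j x hx l y hy
    have hsum : (∑ j : Fin K, ∑ l : Fin K,
        if x ∈ Set.Ico ((j : ℝ) / K) (((j : ℝ) + 1) / K)
            ∧ y ∈ Set.Ico ((l : ℝ) / K) (((l : ℝ) + 1) / K)
          then Θ j l else 0) = Θ j l := by
      rw [Finset.sum_eq_single j, Finset.sum_eq_single l, if_pos ⟨hx, hy⟩]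
      · exact fun i _ hi => if_neg fun h => hi (regularCell_index_unique h.2 hy)
      · simp
      · exact fun i _ hi => Finset.sum_eq_zero fun m _ =>
          if_neg fun h => hi (regularCell_index_unique h.1 hx)
      · simp
    have hx' := regularCell_subset_Icc j hx
    have hy' := regularCell_subset_Icc l hy
    have htj := regularCell_subset_Icc j (ht j)
    have htl := regularCell_subset_Icc l (ht l)
    have hmv := sq_sub_le_iSup_gradient_mul hr (p := (t j, t l)) (q := (x, y))
      ⟨⟨htj.1, htl.1⟩, ⟨htj.2, htl.2⟩⟩ ⟨⟨hx'.1, hy'.1⟩, ⟨hx'.2, hy'.2⟩⟩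
    rw [← hG] at hmv
    have hmul := mul_le_mul_of_nonneg_left (add_le_add (hdist j x hx) (hdist l y hy)) hG0
    rw [hsum]
    dsimp only at hmv
    nlinarith [sq_nonneg ((Θ j l - r (t j, t l)) - (r (t j, t l) - r (x, y)))]
  refine (setIntegral_le_of_le_on_regularCells hK
    (fun x => integral_nonneg fun y => sq_nonneg _)
    fun j x hx => setIntegral_le_of_le_on_regularCells hK (fun y => sq_nonneg _)
      (hcell j x hx)).trans (le_of_eq ?_)
  simp only [Finset.sum_add_distrib, ← Finset.mul_sum, Finset.sum_const, Finset.card_univ,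
    Fintype.card_fin, nsmul_eq_mul]
  field_simp
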